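/- arXiv:1911.05167 — 3 statements merged into one kernel-verified Lean document; each statement's English description precedes it below -/
import Mathlib

section
/- Let f₁ : ℝ^d → ℝ^l be differentiable at x ∈ ℝ^d with Jacobian f₁'(x) ∈ ℝ^{l×d}, and let f₂ : ℝ^l → ℝ be differentiable with ‖∇f₂(u)‖ ≤ ℓ₂ for all u and ‖∇f₂(u) − ∇f₂(u')‖ ≤ L₂‖u − u'‖ for all u, u'. Then for every matrix Z₁ ∈ ℝ^{l×d} and all vectors Y, Z₂ ∈ ℝ^l, the nested-gradient estimator v = Z₁ᵀZ₂ satisfies ‖Z₁ᵀZ₂ − f₁'(x)ᵀ∇f₂(f₁(x))‖² ≤ 3‖Z₁‖²(‖Z₂ − ∇f₂(Y)‖² + L₂²‖Y − f₁(x)‖²) + 3ℓ₂²‖Z₁ − f₁'(x)‖². -/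
open ContinuousLinearMap

/-- Error of approximating `B† w` by `A† z`, split at an intermediate vector `y`. -/
theorem norm_sq_adjoint_apply_sub_adjoint_apply_le {E F : Type*}
    [NormedAddCommGroup E] [InnerProductSpace ℝ E] [CompleteSpace E]
    [NormedAddCommGroup F] [InnerProductSpace ℝ F] [CompleteSpace F]
    (A B : E →L[ℝ] F) (z y w : F) :
    ‖adjoint A z - adjoint B w‖ ^ 2 ≤
      3 * ‖A‖ ^ 2 * (‖z - y‖ ^ 2 + ‖y - w‖ ^ 2) + 3 * ‖w‖ ^ 2 * ‖A - B‖ ^ 2 := by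
  have adjoint_le (T : E →L[ℝ] F) (v : F) : ‖adjoint T v‖ ≤ ‖T‖ * ‖v‖ := by
    simpa only [LinearIsometryEquiv.norm_map] using (adjoint T).le_opNorm v
  have split : adjoint A z - adjoint B w =
      adjoint A (z - y) + adjoint A (y - w) + adjoint (A - B) w := by
    simp only [map_sub, sub_apply]
    abel
  have triangle : ‖adjoint A z - adjoint B w‖ ≤
      ‖A‖ * ‖z - y‖ + ‖A‖ * ‖y - w‖ + ‖A - B‖ * ‖w‖ := by
    rw [split]
    exact norm_add₃_le.trans
      (add_le_add_three (adjoint_le _ _) (adjoint_le _ _) (adjoint_le _ _))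
  have sq_add_le (a b c : ℝ) : (a + b + c) ^ 2 ≤ 3 * (a ^ 2 + b ^ 2 + c ^ 2) := by
    linarith [sq_nonneg (a - b), sq_nonneg (b - c), sq_nonneg (a - c)]
  calc ‖adjoint A z - adjoint B w‖ ^ 2
      ≤ (‖A‖ * ‖z - y‖ + ‖A‖ * ‖y - w‖ + ‖A - B‖ * ‖w‖) ^ 2 := by gcongr
    _ ≤ _ := sq_add_le _ _ _
    _ = _ := by ring

/-- Deterministic error bound for the nested-gradient estimator
`v = Z₁ᵀ Z₂` of `F'(x) = f₁'(x)ᵀ ∇f₂(f₁(x))`. -/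
theorem nested_gradient_estimator_bound {d l : ℕ}
    (f₁ : EuclideanSpace ℝ (Fin d) → EuclideanSpace ℝ (Fin l))
    (f₂ : EuclideanSpace ℝ (Fin l) → ℝ)
    (x : EuclideanSpace ℝ (Fin d)) (ℓ₂ L₂ : ℝ)
    (hf₁ : DifferentiableAt ℝ f₁ x)
    (hf₂ : Differentiable ℝ f₂)
    (hgrad_bound : ∀ u, ‖gradient f₂ u‖ ≤ ℓ₂)
    (hgrad_lip : ∀ u u', ‖gradient f₂ u - gradient f₂ u'‖ ≤ L₂ * ‖u - u'‖)
    (Z₁ : EuclideanSpace ℝ (Fin d) →L[ℝ] EuclideanSpace ℝ (Fin l))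
    (Y Z₂ : EuclideanSpace ℝ (Fin l)) :
    ‖(adjoint Z₁) Z₂ - (adjoint (fderiv ℝ f₁ x)) (gradient f₂ (f₁ x))‖ ^ 2 ≤
      3 * ‖Z₁‖ ^ 2 * (‖Z₂ - gradient f₂ Y‖ ^ 2 + L₂ ^ 2 * ‖Y - f₁ x‖ ^ 2) +
        3 * ℓ₂ ^ 2 * ‖Z₁ - fderiv ℝ f₁ x‖ ^ 2 := by
  have lip := hgrad_lip Y (f₁ x)
  have bound := hgrad_bound (f₁ x)
  refine (norm_sq_adjoint_apply_sub_adjoint_apply_le Z₁ (fderiv ℝ f₁ x) Z₂ (gradient f₂ Y)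
    (gradient f₂ (f₁ x))).trans ?_
  rw [← mul_pow L₂]
  gcongr
end

section
/- Let A ∈ ℝ^{p×d} be such that AAᵀ is positive definite with smallest eigenvalue λ > 0, let G ∈ ℝ^{d×d}, η > 0, and let F : ℝ^d → ℝ be differentiable with L-Lipschitz gradient. Suppose x⁻, x, x⁺, v, v' ∈ ℝ^d and z, z' ∈ ℝ^p satisfy Aᵀz = v + (1/η)G(x⁺ − x), Aᵀz' = v' + (1/η)G(x − x⁻), ‖v − ∇F(x)‖² ≤ C and ‖v' − ∇F(x⁻)‖² ≤ C. Then ‖z − z'‖² ≤ 18C/λ + (3‖G‖²/(λη²))‖x⁺ − x‖² + (9L²/λ + 3‖G‖²/(λη²))‖x − x⁻‖². -/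
open ContinuousLinearMap

/-- The smallest spectral value of `A Aᵀ` bounds `‖Aᵀ w‖²` from below. -/
theorem sInf_spectrum_mul_norm_sq_le {E H : Type*}
    [NormedAddCommGroup E] [InnerProductSpace ℝ E] [CompleteSpace E]
    [NormedAddCommGroup H] [InnerProductSpace ℝ H] [FiniteDimensional ℝ H] [CompleteSpace H]
    (A : E →L[ℝ] H) (w : H) :
    sInf (spectrum ℝ (A ∘L adjoint A)) * ‖w‖ ^ 2 ≤ ‖adjoint A w‖ ^ 2 := by
  rcases eq_or_ne w 0 with rfl | hw
  · simp
  have : Nontrivial H := ⟨w, 0, hw⟩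
  set T : H →L[ℝ] H := A ∘L adjoint A with hT
  have inner_T : ∀ y, inner ℝ (T y) y = ‖adjoint A y‖ ^ 2 := fun y => by
    rw [hT, comp_apply, ← adjoint_inner_right, real_inner_self_eq_norm_sq]
  have symm_T : (T : H →ₗ[ℝ] H).IsSymmetric := fun x y => by
    simp only [hT, coe_coe, comp_apply]
    rw [← adjoint_inner_right, adjoint_inner_left]
  have eig := symm_T.hasEigenvalue_iInf_of_finiteDimensional
  have mem : (⨅ x : { x : H // x ≠ 0 }, inner ℝ (T x) (x : H) / ‖(x : H)‖ ^ 2) ∈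
      spectrum ℝ T := by
    have h := eig.mem_spectrum
    rwa [← ContinuousLinearMap.spectrum_eq] at h
  have le_w : (⨅ x : { x : H // x ≠ 0 }, inner ℝ (T x) (x : H) / ‖(x : H)‖ ^ 2) ≤
      inner ℝ (T w) w / ‖w‖ ^ 2 := by
    refine ciInf_le (f := fun x : { x : H // x ≠ 0 } =>
      inner ℝ (T x) (x : H) / ‖(x : H)‖ ^ 2) ⟨0, ?_⟩ ⟨w, hw⟩
    rintro _ ⟨x, rfl⟩
    simp only [inner_T]
    positivity
  have le := (csInf_le (spectrum.isCompact T).bddBelow mem).trans le_w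
  rwa [inner_T, le_div_iff₀ (by positivity)] at le

theorem norm_add_add_sq_le {E : Type*} [SeminormedAddCommGroup E] (a b c : E) :
    ‖a + b + c‖ ^ 2 ≤ 3 * (‖a‖ ^ 2 + ‖b‖ ^ 2 + ‖c‖ ^ 2) := by
  have h : ‖a + b + c‖ ≤ ‖a‖ + ‖b‖ + ‖c‖ := norm_add₃_le
  have h' := pow_le_pow_left₀ (norm_nonneg _) h 2
  nlinarith [sq_nonneg (‖a‖ - ‖b‖), sq_nonneg (‖b‖ - ‖c‖), sq_nonneg (‖a‖ - ‖c‖)]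

/-- Bound on the difference of consecutive ADMM dual variables,
where `lam` is the smallest eigenvalue of `A Aᵀ` (the infimum of its spectrum). -/
theorem admm_dual_variable_bound {d p : ℕ}
    (A : EuclideanSpace ℝ (Fin d) →L[ℝ] EuclideanSpace ℝ (Fin p))
    (lam : ℝ) (hlam_pos : 0 < lam)
    (hlam : lam = sInf (spectrum ℝ (A ∘L adjoint A)))
    (G : EuclideanSpace ℝ (Fin d) →L[ℝ] EuclideanSpace ℝ (Fin d))
    (η : ℝ) (hη : 0 < η)
    (F : EuclideanSpace ℝ (Fin d) → ℝ) (L C : ℝ)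
    (hF : Differentiable ℝ F)
    (hFlip : ∀ a b, ‖gradient F a - gradient F b‖ ≤ L * ‖a - b‖)
    (xm x₀ xp v v' : EuclideanSpace ℝ (Fin d))
    (z z' : EuclideanSpace ℝ (Fin p))
    (hz : adjoint A z = v + η⁻¹ • G (xp - x₀))
    (hz' : adjoint A z' = v' + η⁻¹ • G (x₀ - xm))
    (hv : ‖v - gradient F x₀‖ ^ 2 ≤ C)
    (hv' : ‖v' - gradient F xm‖ ^ 2 ≤ C) :
    ‖z - z'‖ ^ 2 ≤ 18 * C / lam + (3 * ‖G‖ ^ 2 / (lam * η ^ 2)) * ‖xp - x₀‖ ^ 2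
      + (9 * L ^ 2 / lam + 3 * ‖G‖ ^ 2 / (lam * η ^ 2)) * ‖x₀ - xm‖ ^ 2 := by
  have coercive := sInf_spectrum_mul_norm_sq_le A (z - z')
  rw [← hlam] at coercive
  have split : adjoint A (z - z') =
      (v - v') + η⁻¹ • G (xp - x₀) + -(η⁻¹ • G (x₀ - xm)) := by
    rw [map_sub, hz, hz']; abel
  have split_v : v - v' =
      (v - gradient F x₀) + (gradient F x₀ - gradient F xm) + -(v' - gradient F xm) := by abel
  have bound_G : ∀ y, ‖η⁻¹ • G y‖ ^ 2 ≤ ‖G‖ ^ 2 / η ^ 2 * ‖y‖ ^ 2 := fun y => by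
    have h := pow_le_pow_left₀ (norm_nonneg _) (G.le_opNorm y) 2
    rw [norm_smul, norm_inv, Real.norm_of_nonneg hη.le, mul_pow, inv_pow]
    calc (η ^ 2)⁻¹ * ‖G y‖ ^ 2 ≤ (η ^ 2)⁻¹ * (‖G‖ * ‖y‖) ^ 2 := by gcongr
      _ = _ := by ring
  have bound_grad := pow_le_pow_left₀ (norm_nonneg _) (hFlip x₀ xm) 2
  have bound_v := norm_add_add_sq_le (v - gradient F x₀) (gradient F x₀ - gradient F xm)
    (-(v' - gradient F xm))
  rw [← split_v, norm_neg] at bound_v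
  have bound := norm_add_add_sq_le (v - v') (η⁻¹ • G (xp - x₀)) (-(η⁻¹ • G (x₀ - xm)))
  rw [← split, norm_neg] at bound
  have total : lam * ‖z - z'‖ ^ 2 ≤ 18 * C + 3 * (‖G‖ ^ 2 / η ^ 2 * ‖xp - x₀‖ ^ 2)
      + (9 * (L * ‖x₀ - xm‖) ^ 2 + 3 * (‖G‖ ^ 2 / η ^ 2 * ‖x₀ - xm‖ ^ 2)) := by
    linarith [bound_G (xp - x₀), bound_G (x₀ - xm)]
  rw [mul_comm, ← le_div_iff₀ hlam_pos] at total
  refine total.trans_eq ?_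
  field_simp
end

section
/- In the setting of the augmented Lagrangian L_ρ, fix an index 1 ≤ j ≤ m, a point x ∈ ℝ^d, a dual vector z ∈ ℝ^p, updated blocks y⁺_1, …, y⁺_{j−1} ∈ ℝ^l, current blocks y_j, …, y_m ∈ ℝ^l, and a symmetric positive definite matrix H_j ∈ ℝ^{l×l} with smallest eigenvalue λ_min(H_j). Suppose g_j is convex and y_j⁺ ∈ ℝ^l admits a subgradient u_j of g_j at y_j⁺ (i.e., g_j(w) ≥ g_j(y_j⁺) + ⟨u_j, w − y_j⁺⟩ for all w ∈ ℝ^l) satisfying u_j − B_jᵀz + ρB_jᵀ(Ax + Σ_{i<j} B_i y⁺_i + B_j y_j⁺ + Σ_{i>j} B_i y_i − c) + H_j(y_j⁺ − y_j) = 0. Then L_ρ(x, (y⁺_1,…,y⁺_{j−1}, y_j⁺, y_{j+1},…,y_m), z) − L_ρ(x, (y⁺_1,…,y⁺_{j−1}, y_j, y_{j+1},…,y_m), z) ≤ −λ_min(H_j)‖y_j⁺ − y_j‖². -/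
open ContinuousLinearMap
open scoped RealInnerProductSpace

/-- The augmented Lagrangian `L_ρ(x, y, z)`. -/
noncomputable def augLag {d l p m : ℕ}
    (F : EuclideanSpace ℝ (Fin d) → ℝ)
    (g : Fin m → EuclideanSpace ℝ (Fin l) → ℝ)
    (A : EuclideanSpace ℝ (Fin d) →L[ℝ] EuclideanSpace ℝ (Fin p))
    (B : Fin m → EuclideanSpace ℝ (Fin l) →L[ℝ] EuclideanSpace ℝ (Fin p))
    (c : EuclideanSpace ℝ (Fin p)) (ρ : ℝ)
    (x : EuclideanSpace ℝ (Fin d)) (y : Fin m → EuclideanSpace ℝ (Fin l))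
    (z : EuclideanSpace ℝ (Fin p)) : ℝ :=
  F x + ∑ j, g j (y j) - ⟪z, A x + ∑ j, B j (y j) - c⟫ +
    (ρ / 2) * ‖A x + ∑ j, B j (y j) - c‖ ^ 2

/-- A self-adjoint operator on a finite-dimensional real inner product space is bounded below, as a
quadratic form, by the infimum of its spectrum. -/
theorem IsSelfAdjoint.sInf_spectrum_mul_norm_sq_le_inner {E : Type*} [NormedAddCommGroup E]
    [InnerProductSpace ℝ E] [FiniteDimensional ℝ E] [CompleteSpace E] {T : E →L[ℝ] E}
    (hT : IsSelfAdjoint T) (v : E) : sInf (spectrum ℝ T) * ‖v‖ ^ 2 ≤ ⟪T v, v⟫ := by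
  have hsym : (T : E →ₗ[ℝ] E).IsSymmetric := hT.isSymmetric
  let b := hsym.eigenvectorBasis rfl
  have hTb (i) : T (b i) = hsym.eigenvalues rfl i • b i :=
    hsym.apply_eigenvectorBasis rfl i
  have hbdd : BddBelow (spectrum ℝ T) := (spectrum.isCompact T).bddBelow
  have hmem (i) : hsym.eigenvalues rfl i ∈ spectrum ℝ T := by
    rw [spectrum.mem_iff]
    intro hunit
    obtain ⟨S, hS⟩ := hunit.exists_left_inv
    have h0 : (algebraMap ℝ (E →L[ℝ] E) (hsym.eigenvalues rfl i) - T) (b i) = 0 := by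
      simp [Algebra.algebraMap_eq_smul_one, hTb]
    have h1 := congrArg (fun R : E →L[ℝ] E => R (b i)) hS
    simp only [mul_apply_eq_comp, h0, map_zero, one_apply_eq_self] at h1
    exact b.orthonormal.ne_zero i h1.symm
  have hinner : ⟪T v, v⟫ = ∑ i, hsym.eigenvalues rfl i * ⟪b i, v⟫ ^ 2 := by
    rw [← b.sum_inner_mul_inner]
    refine Finset.sum_congr rfl fun i _ => ?_
    have h : ⟪T v, b i⟫ = ⟪v, T (b i)⟫ := hsym v (b i)
    rw [h, hTb, real_inner_smul_right, real_inner_comm]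
    ring
  have hnorm : ‖v‖ ^ 2 = ∑ i, ⟪b i, v⟫ ^ 2 := by
    simpa using (b.sum_sq_norm_inner_right v).symm
  rw [hinner, hnorm, Finset.mul_sum]
  gcongr with i
  exact csInf_le hbdd (hmem i)

/-- Replacing one entry of a family changes the sum of its images by the change of that entry. -/
theorem Finset.sum_apply_update {ι α M : Type*} [Fintype ι] [DecidableEq ι] [AddCommGroup M]
    (f : ι → α → M) (Y : ι → α) (j : ι) (a : α) :
    ∑ i, f i (Function.update Y j a i) = ∑ i, f i (Y i) + (f j a - f j (Y j)) := by
  rw [← sub_eq_iff_eq_add', ← Finset.sum_sub_distrib, Finset.sum_eq_single j]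
  · simp
  · intro i _ hi
    simp [Function.update_of_ne hi]
  · simp

/-- Descent of the augmented Lagrangian along the proximal-style
update of a single block `y_j`, where `lminH` is the smallest eigenvalue of the
symmetric positive definite matrix `H_j`. -/
theorem admm_block_descent {d l p m : ℕ}
    (F : EuclideanSpace ℝ (Fin d) → ℝ)
    (g : Fin m → EuclideanSpace ℝ (Fin l) → ℝ)
    (A : EuclideanSpace ℝ (Fin d) →L[ℝ] EuclideanSpace ℝ (Fin p))
    (B : Fin m → EuclideanSpace ℝ (Fin l) →L[ℝ] EuclideanSpace ℝ (Fin p))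
    (c : EuclideanSpace ℝ (Fin p)) (ρ : ℝ) (hρ : 0 < ρ)
    (j : Fin m) (x : EuclideanSpace ℝ (Fin d)) (z : EuclideanSpace ℝ (Fin p))
    (Y : Fin m → EuclideanSpace ℝ (Fin l)) (yplus : EuclideanSpace ℝ (Fin l))
    (Hj : EuclideanSpace ℝ (Fin l) →L[ℝ] EuclideanSpace ℝ (Fin l))
    (hHsa : IsSelfAdjoint Hj) (lminH : ℝ)
    (hlminH : lminH = sInf (spectrum ℝ Hj)) (hlminH_pos : 0 < lminH)
    (hconv : ConvexOn ℝ Set.univ (g j))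
    (u : EuclideanSpace ℝ (Fin l))
    (hsub : ∀ w, g j yplus + ⟪u, w - yplus⟫ ≤ g j w)
    (hopt : u - adjoint (B j) z +
        ρ • adjoint (B j) (A x + ∑ i, B i (Function.update Y j yplus i) - c) +
        Hj (yplus - Y j) = 0) :
    augLag F g A B c ρ x (Function.update Y j yplus) z - augLag F g A B c ρ x Y z ≤
      -(lminH * ‖yplus - Y j‖ ^ 2) := by
  set e := yplus - Y j with he
  set r := A x + ∑ i, B i (Function.update Y j yplus i) - c with hr
  have hres : A x + ∑ i, B i (Y i) - c = r - B j e := by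
    rw [hr, Finset.sum_apply_update (fun i => B i), he, map_sub]
    abel
  have hH : lminH * ‖e‖ ^ 2 ≤ ⟪Hj e, e⟫ :=
    hlminH ▸ hHsa.sInf_spectrum_mul_norm_sq_le_inner e
  have hstat := congrArg (fun v => ⟪v, e⟫) hopt
  simp only [inner_add_left, inner_sub_left, real_inner_smul_left, adjoint_inner_left,
    inner_zero_left] at hstat
  have hg := hsub (Y j)
  rw [← neg_sub yplus (Y j), ← he, inner_neg_right] at hg
  simp only [augLag]
  rw [← hr, hres, Finset.sum_apply_update g, inner_sub_right z r, norm_sub_sq_real r]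
  linarith [mul_nonneg hρ.le (sq_nonneg ‖B j e‖)]
end
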